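/- arXiv:2011.02345 — 2 statements merged into one kernel-verified Lean document; each statement's English description precedes it below -/
import Mathlib

section
/- Let I, J be two bounded intervals of (0,∞), let r ≥ 1, let (j₁,…,j_r) ∈ (ℕ^d)^r be injective (pairwise distinct), let n ∈ (ℤ∖{0})^r, and let h : J^{d-1} → ℝ be measurable. Then for all γ > 0, the Lebesgue measure of { (m,b) ∈ I × J^{d-1} : |h(b) + Σ_{k=1}^r n_k √(m + |j_k|⁴_{(1,b)})| < γ } is ≲_{r,d,I,J} γ^{1/(r(r+1))} (⟨j₁⟩⋯⟨j_r⟩)^{12/(r+1)}, where (1,b) := (1,b₁,…,b_{d-1}) ∈ ℝ^d. -/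
open MeasureTheory
open scoped BigOperators

noncomputable section

namespace BeamPaper

/-- `|j|_c² = Σᵢ cᵢ jᵢ²` for `j ∈ ℕ^d`. -/
def anormSqN (d : ℕ) (c : Fin d → ℝ) (j : Fin d → ℕ) : ℝ := ∑ i, c i * (j i : ℝ) ^ 2

/-- `⟨j⟩ = √(1+|j|²)` for `j ∈ ℕ^d`. -/
def japN (d : ℕ) (j : Fin d → ℕ) : ℝ := Real.sqrt (1 + ∑ i, ((j i : ℝ)) ^ 2)

/-- `(1,b) ∈ ℝ^d` for `b ∈ ℝ^{d-1}`. -/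
def extb (d : ℕ) (b : Fin (d - 1) → ℝ) : Fin d → ℝ :=
  fun i => if h : (i : ℕ) = 0 then 1 else b ⟨(i : ℕ) - 1, by have := i.isLt; omega⟩

lemma rpow_add_mul_le_rpow_sub {α s W z₀ z₁ : ℝ} (hα : 1 / 2 ≤ α) (h₀ : 0 < z₀)
    (hs : 0 < s) (h₁ : z₀ + s ≤ z₁) (hW : z₁ ≤ W) :
    (z₁ ^ α + z₀ ^ α) * s ≤ 4 * W * (z₁ ^ α - z₀ ^ α) := by
  have hz₁ : 0 < z₁ := by linarith
  have hq : 0 < z₁ ^ α := Real.rpow_pos_of_pos hz₁ α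
  set t := (z₀ / z₁) ^ (1 / 2 : ℝ) with ht
  set u := (z₀ / z₁) ^ α with hu
  have hr : 0 < z₀ / z₁ := div_pos h₀ hz₁
  have hr1 : z₀ / z₁ ≤ 1 := by rw [div_le_one hz₁]; linarith
  have hut : u ≤ t := Real.rpow_le_rpow_of_exponent_ge hr hr1 hα
  have ht1 : t ≤ 1 := Real.rpow_le_one hr.le hr1 (by norm_num)
  have ht0 : 0 < t := Real.rpow_pos_of_pos hr _
  have htt : t * t * z₁ = z₀ := by
    rw [ht, ← Real.rpow_add hr]
    norm_num
    field_simp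
  have hz : z₀ ^ α = u * z₁ ^ α := by
    rw [hu, Real.div_rpow h₀.le hz₁.le]
    field_simp
  have key : (1 + u) * s ≤ 4 * W * (1 - u) := by
    calc (1 + u) * s ≤ (1 + t) * (z₁ - t * t * z₁) := by
          apply mul_le_mul (by linarith) (by linarith) hs.le (by linarith)
      _ = z₁ * (1 - t) * (1 + t) ^ 2 := by ring
      _ ≤ z₁ * (1 - t) * 4 := by
          apply mul_le_mul_of_nonneg_left _ (mul_nonneg hz₁.le (by linarith))
          nlinarith
      _ = 4 * z₁ * (1 - t) := by ring
      _ ≤ 4 * W * (1 - u) := by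
          apply mul_le_mul (by linarith) (by linarith) (by linarith) (by linarith)
  rw [hz]
  calc (z₁ ^ α + u * z₁ ^ α) * s = z₁ ^ α * ((1 + u) * s) := by ring
    _ ≤ z₁ ^ α * (4 * W * (1 - u)) := by gcongr
    _ = _ := by ring

lemma hasDerivAt_add_rpow {y x α : ℝ} (h : 0 < x + y) :
    HasDerivAt (fun m : ℝ => (m + y) ^ α) (α * (x + y) ^ (α - 1)) x := by
  have := ((hasDerivAt_id x).add_const y).rpow_const (p := α) (Or.inl h.ne')
  simpa using this

lemma hasDerivAt_rpow_mul_rpow_neg {p q x α : ℝ} (hp : 0 < x + p) (hq : 0 < x + q) :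
    HasDerivAt (fun m : ℝ => (m + q) ^ α * (m + p) ^ (-α))
      (α * (x + q) ^ (α - 1) * ((p - q) * (x + p) ^ (-(α + 1)))) x := by
  refine ((hasDerivAt_add_rpow (α := α) hq).mul
    (hasDerivAt_add_rpow (α := -α) hp)).congr_deriv ?_
  have e1 : (x + q) ^ α = (x + q) ^ (α - 1) * (x + q) := by
    rw [← Real.rpow_add_one hq.ne']; congr 1; ring
  have e2 : (x + p) ^ (-α) = (x + p) ^ (-(α + 1)) * (x + p) := by
    rw [← Real.rpow_add_one hp.ne']; congr 1; ring
  have e3 : -α - 1 = -(α + 1) := by ring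
  rw [e1, e2, e3]
  ring

/-- Eliminating the index `q` from a combination of powers, between two points where
the combination is small. -/
lemma exists_small_elimination {ι : Type*} (T : Finset ι) (a y : ι → ℝ) (q : ι)
    (hy : ∀ l, 0 ≤ y l) {α s γ W x₀ x₁ : ℝ} (hα : 1 / 2 ≤ α) (hs : 0 < s) (hγ : 0 ≤ γ)
    (h₀ : 0 < x₀) (h₁ : x₀ + s ≤ x₁) (hW : x₁ + y q ≤ W)
    (b₀ : |∑ l ∈ T, a l * (x₀ + y l) ^ (-α)| ≤ γ)
    (b₁ : |∑ l ∈ T, a l * (x₁ + y l) ^ (-α)| ≤ γ) :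
    ∃ ξ ∈ Set.Ioo x₀ x₁,
      |∑ l ∈ T, a l * (y l - y q) * (ξ + y l) ^ (-(α + 1))| ≤ γ * (4 * W / s) := by
  have hlt : x₀ < x₁ := by linarith
  have hpos : ∀ x, x₀ ≤ x → ∀ l, 0 < x + y l := fun x hx l => by
    have := hy l
    linarith
  set w : ℝ → ℝ := fun m => ∑ l ∈ T, a l * ((m + y q) ^ α * (m + y l) ^ (-α)) with hw
  have hwd : ∀ x, x₀ ≤ x → HasDerivAt w
      (∑ l ∈ T, a l * (α * (x + y q) ^ (α - 1) * ((y l - y q) * (x + y l) ^ (-(α + 1))))) x :=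
    fun x hx => HasDerivAt.fun_sum fun l _ =>
      (hasDerivAt_rpow_mul_rpow_neg (hpos x hx l) (hpos x hx q)).const_mul (a l)
  have hgd : ∀ x, x₀ ≤ x → HasDerivAt (fun m : ℝ => (m + y q) ^ α)
      (α * (x + y q) ^ (α - 1)) x := fun x hx => hasDerivAt_add_rpow (hpos x hx q)
  obtain ⟨ξ, hξ, he⟩ := exists_ratio_hasDerivAt_eq_ratio_slope w
    (fun x => ∑ l ∈ T, a l *
      (α * (x + y q) ^ (α - 1) * ((y l - y q) * (x + y l) ^ (-(α + 1))))) hlt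
    (fun x hx => (hwd x hx.1).continuousAt.continuousWithinAt)
    (fun x hx => hwd x hx.1.le) (fun m : ℝ => (m + y q) ^ α)
    (fun x => α * (x + y q) ^ (α - 1))
    (fun x hx => (hgd x hx.1).continuousAt.continuousWithinAt)
    (fun x hx => hgd x hx.1.le)
  refine ⟨ξ, hξ, ?_⟩
  set v := ∑ l ∈ T, a l * (y l - y q) * (ξ + y l) ^ (-(α + 1)) with hv
  have hc : 0 < α * (ξ + y q) ^ (α - 1) :=
    mul_pos (by linarith) (Real.rpow_pos_of_pos (hpos ξ hξ.1.le q) _)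
  have hfac : (∑ l ∈ T, a l *
      (α * (ξ + y q) ^ (α - 1) * ((y l - y q) * (ξ + y l) ^ (-(α + 1)))))
      = α * (ξ + y q) ^ (α - 1) * v := by
    rw [hv, Finset.mul_sum]
    exact Finset.sum_congr rfl fun l _ => by ring
  have hwe : ∀ x, w x = (x + y q) ^ α * ∑ l ∈ T, a l * (x + y l) ^ (-α) := fun x => by
    simp only [hw]
    rw [Finset.mul_sum]
    exact Finset.sum_congr rfl fun l _ => by ring
  have hbd : ∀ x, x₀ ≤ x → |∑ l ∈ T, a l * (x + y l) ^ (-α)| ≤ γ →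
      |w x| ≤ (x + y q) ^ α * γ := fun x hx hb => by
    have hp := Real.rpow_pos_of_pos (hpos x hx q) α
    rw [hwe, abs_mul, abs_of_pos hp]
    gcongr
  have h2 : ((x₁ + y q) ^ α - (x₀ + y q) ^ α) * v = w x₁ - w x₀ := by
    simp only [hfac] at he
    have : (α * (ξ + y q) ^ (α - 1)) * (((x₁ + y q) ^ α - (x₀ + y q) ^ α) * v)
        = (α * (ξ + y q) ^ (α - 1)) * (w x₁ - w x₀) := by linarith
    exact mul_left_cancel₀ hc.ne' this
  have hg : 0 < (x₁ + y q) ^ α - (x₀ + y q) ^ α :=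
    sub_pos.2 (Real.rpow_lt_rpow (hpos x₀ le_rfl q).le (by linarith) (by linarith))
  have h3 : ((x₁ + y q) ^ α - (x₀ + y q) ^ α) * |v|
      ≤ ((x₁ + y q) ^ α + (x₀ + y q) ^ α) * γ := by
    have hvw : ((x₁ + y q) ^ α - (x₀ + y q) ^ α) * |v| = |w x₁ - w x₀| := by
      rw [← h2, abs_mul, abs_of_pos hg]
    rw [hvw]
    calc |w x₁ - w x₀| ≤ |w x₁| + |w x₀| := abs_sub _ _
      _ ≤ _ := by
        have := hbd x₀ le_rfl b₀
        have := hbd x₁ hlt.le b₁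
        linarith
  have h4 := rpow_add_mul_le_rpow_sub (z₀ := x₀ + y q) (z₁ := x₁ + y q) hα
    (hpos x₀ le_rfl q) hs (by linarith) hW
  have h5 : γ * (4 * W / s) = γ * (4 * W) / s := by ring
  rw [h5, le_div_iff₀ hs]
  refine le_of_mul_le_mul_left ?_ hg
  calc ((x₁ + y q) ^ α - (x₀ + y q) ^ α) * (|v| * s)
      = ((x₁ + y q) ^ α - (x₀ + y q) ^ α) * |v| * s := by ring
    _ ≤ ((x₁ + y q) ^ α + (x₀ + y q) ^ α) * γ * s := by gcongr
    _ = γ * (((x₁ + y q) ^ α + (x₀ + y q) ^ α) * s) := by ring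
    _ ≤ γ * (4 * W * ((x₁ + y q) ^ α - (x₀ + y q) ^ α)) := by gcongr
    _ = _ := by ring

/-- Halving a spaced family of points, with a new property at points in between. -/
lemma exists_spaced_between {M : ℕ} {s B : ℝ} {x : ℕ → ℝ} {p : ℝ → Prop}
    (hx0 : ∀ i < 2 * M, 0 < x i) (hxB : ∀ i < 2 * M, x i ≤ B)
    (hxs : ∀ i, i + 1 < 2 * M → x i + s ≤ x (i + 1))
    (hp : ∀ i < M, ∃ ξ ∈ Set.Ioo (x (2 * i)) (x (2 * i + 1)), p ξ) :
    ∃ ξ : ℕ → ℝ, (∀ i < M, 0 < ξ i) ∧ (∀ i < M, ξ i ≤ B) ∧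
      (∀ i, i + 1 < M → ξ i + s ≤ ξ (i + 1)) ∧ ∀ i < M, p (ξ i) := by
  choose! ξ hξ hpξ using hp
  refine ⟨ξ, fun i hi => (hx0 (2 * i) (by omega)).trans (hξ i hi).1,
    fun i hi => (hξ i hi).2.le.trans (hxB _ (by omega)), fun i hi => ?_, hpξ⟩
  have h1 := (hξ i (by omega)).2
  have h2 := (hξ (i + 1) hi).1
  have h3 := hxs (2 * i + 1) (by omega)
  have h4 : 2 * i + 1 + 1 = 2 * (i + 1) := by ring
  rw [h4] at h3
  linarith

lemma abs_coeff_mul_prod_le {ι : Type*} [DecidableEq ι] (k : ι) (S : Finset ι) (hk : k ∉ S)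
    (y W : ι → ℝ) (hy : ∀ l, 0 ≤ y l) {s B : ℝ} (hs : 0 < s) (hW : ∀ l, B + y l ≤ W l)
    (a : ι → ℝ) {α γ : ℝ} (hα : 1 / 2 ≤ α) (hγ : 0 ≤ γ) (x : ℕ → ℝ)
    (hx0 : ∀ i < 2 ^ S.card, 0 < x i) (hxB : ∀ i < 2 ^ S.card, x i ≤ B)
    (hxs : ∀ i, i + 1 < 2 ^ S.card → x i + s ≤ x (i + 1))
    (hx : ∀ i < 2 ^ S.card, |∑ l ∈ insert k S, a l * (x i + y l) ^ (-α)| ≤ γ) :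
    |a k| * ∏ l ∈ S, |y k - y l| ≤ γ * W k ^ (α + S.card) * ∏ l ∈ S, (4 * W l / s) := by
  induction S using Finset.induction_on generalizing a α γ x with
  | empty =>
    have h0 := hx0 0 (by simp)
    have h1 := hxB 0 (by simp)
    have h2 := hx 0 (by simp)
    have hz : 0 < x 0 + y k := by linarith [hy k]
    simp only [insert_empty_eq, Finset.sum_singleton] at h2
    rw [abs_mul, abs_of_pos (Real.rpow_pos_of_pos hz _), Real.rpow_neg hz.le,
      ← div_eq_mul_inv, div_le_iff₀ (Real.rpow_pos_of_pos hz _)] at h2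
    simp only [Finset.prod_empty, mul_one, Finset.card_empty, Nat.cast_zero, add_zero]
    refine h2.trans ?_
    gcongr
    linarith [hW k]
  | insert q S hq ih =>
    have hkq : k ≠ q := fun h => hk (by simp [h])
    have hkS : k ∉ S := fun h => hk (by simp [h])
    rw [Finset.card_insert_of_notMem hq] at hx0 hxB hxs hx ⊢
    rw [pow_succ'] at hx0 hxB hxs hx
    obtain ⟨ξ, c0, cB, cs, cp⟩ := exists_spaced_between hx0 hxB hxs
      (p := fun ξ => |∑ l ∈ insert k (insert q S), a l * (y l - y q) * (ξ + y l) ^ (-(α + 1))|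
        ≤ γ * (4 * W q / s)) fun i hi =>
          exists_small_elimination _ a y q hy hα hs hγ (hx0 _ (by omega)) (hxs _ (by omega))
            ((add_le_add_left (hxB _ (by omega)) (y q)).trans (hW q))
            (hx _ (by omega)) (hx _ (by omega))
    have hB : 0 < B := (c0 0 (by positivity)).trans_le (cB 0 (by positivity))
    have hWq : 0 < W q := by linarith [hW q, hy q]
    have := ih hkS (fun l => a l * (y l - y q)) (α := α + 1) (γ := γ * (4 * W q / s))
      (by linarith) (by positivity) ξ c0 cB cs (fun i hi => by
        have h := cp i hi
        rw [Finset.insert_comm, Finset.sum_insert (by simp [hq, hkq.symm])] at h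
        simpa using h)
    rw [Finset.prod_insert hq, Finset.prod_insert hq]
    have e : α + ((S.card + 1 : ℕ) : ℝ) = α + 1 + S.card := by push_cast; ring
    rw [e]
    rw [abs_mul] at this
    calc _ = |a k| * |y k - y q| * ∏ l ∈ S, |y k - y l| := by ring
      _ ≤ _ := this
      _ = _ := by ring

/-- A set of large outer measure contains many well spaced points. -/
lemma exists_spaced_of_lt_volume {s : ℝ} (hs : 0 < s) (N : ℕ) (E : Set ℝ)
    (hE : BddBelow E) (hv : ENNReal.ofReal (2 * s * N) < volume E) :
    ∃ x : ℕ → ℝ, (∀ i ≤ N, x i ∈ E) ∧ ∀ i < N, x i + s ≤ x (i + 1) := by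
  have hne : E.Nonempty := by
    by_contra h
    rw [Set.not_nonempty_iff_eq_empty] at h
    simp [h] at hv
  induction N generalizing E with
  | zero =>
    obtain ⟨e, he⟩ := hne
    exact ⟨fun _ => e, fun _ _ => he, by simp⟩
  | succ N ih =>
    obtain ⟨e, he, hes⟩ := Real.lt_sInf_add_pos hne hs
    have hsub : E ⊆ Set.Ico (sInf E) (sInf E + 2 * s) ∪ (E ∩ Set.Ici (e + s)) := by
      intro t ht
      by_cases h : e + s ≤ t
      · exact Or.inr ⟨ht, h⟩
      · exact Or.inl ⟨csInf_le hE ht, by linarith⟩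
    have h1 : volume E ≤ ENNReal.ofReal (2 * s) + volume (E ∩ Set.Ici (e + s)) := by
      refine (measure_mono hsub).trans ((measure_union_le _ _).trans ?_)
      simp
    have h2 : ENNReal.ofReal (2 * s * N) < volume (E ∩ Set.Ici (e + s)) := by
      have e1 : ENNReal.ofReal (2 * s * (N + 1 : ℕ))
          = ENNReal.ofReal (2 * s) + ENNReal.ofReal (2 * s * N) := by
        rw [← ENNReal.ofReal_add (by positivity) (by positivity)]
        congr 1; push_cast; ring
      rw [e1] at hv
      exact lt_of_add_lt_add_left (hv.trans_le h1)
    obtain ⟨x, hxE, hxs⟩ := ih (E ∩ Set.Ici (e + s)) (hE.mono Set.inter_subset_left) h2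
      (nonempty_of_measure_ne_zero (zero_le.trans_lt h2).ne')
    refine ⟨fun i => Nat.casesOn i e x, ?_, ?_⟩
    · rintro (_ | i) hi
      · exact he
      · exact (hxE i (by omega)).1
    · rintro (_ | i) hi
      · exact (hxE 0 (by omega)).2
      · exact hxs i (by omega)

/-- Sublevel set estimate for a combination of `√(m + y l)`. -/
lemma volume_sublevel_sqrt_le {ι : Type*} [DecidableEq ι] [Fintype ι] (k : ι)
    (y W : ι → ℝ) (hy : ∀ l, 0 ≤ y l) {s B : ℝ} (hs : 0 < s) (hW : ∀ l, B + y l ≤ W l)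
    (n : ι → ℝ) (c : ℝ) {γ : ℝ} (hγ : 0 ≤ γ) (E : Set ℝ) (hE : E ⊆ Set.Ioc 0 B)
    (hEγ : ∀ m ∈ E, |c + ∑ l, n l * Real.sqrt (m + y l)| ≤ γ)
    (hlt : 4 * γ / s * W k ^ ((Fintype.card ι : ℝ) - 1 / 2) *
      ∏ l ∈ Finset.univ.erase k, (4 * W l / s) <
        |n k| * ∏ l ∈ Finset.univ.erase k, |y k - y l|) :
    volume E ≤ ENNReal.ofReal (2 * s * 2 ^ Fintype.card ι) := by
  by_contra! hv
  obtain ⟨x, hxE, hxs⟩ := exists_spaced_of_lt_volume hs (2 ^ Fintype.card ι) E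
    ⟨0, fun t ht => (hE ht).1.le⟩ (by push_cast; exact hv)
  have hk : k ∉ Finset.univ.erase k := by simp
  have hins : insert k (Finset.univ.erase k) = Finset.univ := Finset.insert_erase (by simp)
  have hcard : (Finset.univ.erase k).card + 1 = Fintype.card ι :=
    Finset.card_erase_add_one (by simp)
  set S := Finset.univ.erase k with hS
  rw [← hcard, pow_succ'] at hxE hxs
  obtain ⟨ξ, c0, cB, cs, cp⟩ := exists_spaced_between (M := 2 ^ S.card) (s := s) (B := B) (x := x)
    (fun i hi => (hE (hxE i hi.le)).1) (fun i hi => (hE (hxE i hi.le)).2)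
    (fun i hi => hxs i (by omega))
    (p := fun ξ => |∑ l ∈ insert k S, n l * (ξ + y l) ^ (-(1 / 2) : ℝ)| ≤ 4 * γ / s)
    (fun i hi => by
      have hd : ∀ t ∈ Set.Icc (x (2 * i)) (x (2 * i + 1)),
          HasDerivAt (fun m => c + ∑ l, n l * Real.sqrt (m + y l))
            (∑ l, n l * (1 / 2 * (t + y l) ^ (1 / 2 - 1 : ℝ))) t := fun t ht => by
        simp only [Real.sqrt_eq_rpow]
        refine HasDerivAt.const_add _ (HasDerivAt.fun_sum fun l _ => ?_)
        refine (hasDerivAt_add_rpow ?_).const_mul _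
        have := (hE (hxE (2 * i) (by omega))).1
        linarith [hy l, ht.1]
      have hsp := hxs (2 * i) (by omega)
      obtain ⟨ξ, hξ, he⟩ := exists_hasDerivAt_eq_slope _ _
        (show x (2 * i) < x (2 * i + 1) by linarith)
        (fun t ht => (hd t ht).continuousAt.continuousWithinAt)
        (fun t ht => hd t (Set.Ioo_subset_Icc_self ht))
      refine ⟨ξ, hξ, ?_⟩
      have e1 : ∑ l ∈ insert k S, n l * (ξ + y l) ^ (-(1 / 2) : ℝ)
          = 2 * ∑ l, n l * (1 / 2 * (ξ + y l) ^ (1 / 2 - 1 : ℝ)) := by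
        rw [hins, Finset.mul_sum]
        refine Finset.sum_congr rfl fun l _ => ?_
        rw [show (1 / 2 - 1 : ℝ) = -(1 / 2) by norm_num]
        ring
      have b1 := abs_le.1 (hEγ _ (hxE (2 * i) (by omega)))
      have b2 := abs_le.1 (hEγ _ (hxE (2 * i + 1) (by omega)))
      rw [e1, he, abs_mul, abs_div, abs_of_pos (show (0 : ℝ) < 2 by norm_num),
        abs_of_pos (show 0 < x (2 * i + 1) - x (2 * i) by linarith)]
      have h3 : |(c + ∑ l, n l * Real.sqrt (x (2 * i + 1) + y l)) -
          (c + ∑ l, n l * Real.sqrt (x (2 * i) + y l))| ≤ 2 * γ :=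
        abs_le.2 ⟨by linarith [b1.2, b2.1], by linarith [b1.1, b2.2]⟩
      calc _ ≤ 2 * (2 * γ / s) := by
            gcongr
            linarith
        _ = _ := by ring)
  have := abs_coeff_mul_prod_le k S hk y W hy hs hW n (α := 1 / 2) le_rfl
    (γ := 4 * γ / s) (by positivity) ξ c0 cB cs cp
  have e : (1 / 2 : ℝ) + S.card = (Fintype.card ι : ℝ) - 1 / 2 := by
    rw [← hcard]; push_cast; ring
  rw [e] at this
  exact absurd this (not_le.2 hlt)

lemma prod_apply_le_mul_of_slice_le {X Y : Type*} [MeasurableSpace X] [MeasurableSpace Y]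
    (μ : Measure X) (ν : Measure Y) [SFinite μ] [SFinite ν] {S : Set (X × Y)}
    (hS : MeasurableSet S) {T : Set Y} (hT : MeasurableSet T) (hST : ∀ p ∈ S, p.2 ∈ T)
    {c : ENNReal} (hc : ∀ b ∈ T, μ ((fun a => (a, b)) ⁻¹' S) ≤ c) :
    (μ.prod ν) S ≤ c * ν T := by
  rw [Measure.prod_apply_symm hS, ← lintegral_indicator_const hT]
  refine lintegral_mono fun b => ?_
  by_cases hb : b ∈ T
  · simpa [hb] using hc b hb
  · have : (fun a => (a, b)) ⁻¹' S = ∅ := by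
      ext a
      simp only [Set.mem_preimage, Set.mem_empty_iff_false, iff_false]
      exact fun h => hb (hST _ h)
    simp [this]

lemma volume_abs_affine_lt_le {a c η : ℝ} (ha : 1 ≤ |a|) (hη : 0 ≤ η) :
    volume {t : ℝ | |c + a * t| < η} ≤ ENNReal.ofReal (2 * η) := by
  have ha0 : a ≠ 0 := by
    rintro rfl
    norm_num at ha
  have : {t : ℝ | |c + a * t| < η} ⊆ Metric.ball (-c / a) η := by
    intro t ht
    have h1 : |c + a * t| = |a| * |t - -c / a| := by
      rw [← abs_mul]; congr 1; field_simp; ring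
    simp only [Set.mem_ofPred_eq, h1] at ht
    rw [Metric.mem_ball, Real.dist_eq]
    nlinarith [abs_nonneg (t - -c / a)]
  exact (measure_mono this).trans (by rw [Real.volume_ball])

lemma volume_pi_Ioc_le {n : ℕ} {B : ℝ} (hB : 0 ≤ B) :
    volume (Set.univ.pi fun _ : Fin n => Set.Ioc 0 B) ≤ ENNReal.ofReal (B ^ n) := by
  rw [volume_pi_pi]
  simp [ENNReal.ofReal_pow hB]

/-- Measure of the part of a box inside a thin slab around a hyperplane. -/
lemma volume_slab_le {n : ℕ} {B η c : ℝ} (hB : 1 ≤ B) (hη : 0 ≤ η) (a : Fin n → ℝ)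
    (i : Fin n) (ha : 1 ≤ |a i|) :
    volume {b : Fin n → ℝ | (∀ i, b i ∈ Set.Ioc 0 B) ∧ |c + ∑ i, a i * b i| < η}
      ≤ ENNReal.ofReal (2 * η * B ^ n) := by
  obtain _ | n := n
  · exact i.elim0
  set A : Set (ℝ × (Fin n → ℝ)) := {p | p.1 ∈ Set.Ioc 0 B ∧ (∀ l, p.2 l ∈ Set.Ioc 0 B) ∧
    |c + (a i * p.1 + ∑ l, a (i.succAbove l) * p.2 l)| < η} with hA
  have hbox : MeasurableSet {p : ℝ × (Fin n → ℝ) | ∀ l, p.2 l ∈ Set.Ioc 0 B} := by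
    have : {p : ℝ × (Fin n → ℝ) | ∀ l, p.2 l ∈ Set.Ioc 0 B}
        = Prod.snd ⁻¹' Set.univ.pi fun _ => Set.Ioc 0 B := by
      ext p
      simp
    rw [this]
    exact (MeasurableSet.univ_pi fun _ => measurableSet_Ioc).preimage measurable_snd
  have hslab : MeasurableSet {p : ℝ × (Fin n → ℝ) |
      |c + (a i * p.1 + ∑ l, a (i.succAbove l) * p.2 l)| < η} :=
    measurableSet_lt (by fun_prop) (by fun_prop)
  have hAm : MeasurableSet A :=
    (measurableSet_Ioc.preimage measurable_fst).inter (hbox.inter hslab)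
  have hpre : {b : Fin (n + 1) → ℝ | (∀ i, b i ∈ Set.Ioc 0 B) ∧ |c + ∑ i, a i * b i| < η}
      = (MeasurableEquiv.piFinSuccAbove (fun _ => ℝ) i) ⁻¹' A := by
    ext b
    simp only [Set.mem_ofPred_eq, hA, Set.mem_preimage, MeasurableEquiv.piFinSuccAbove_apply,
      Fin.insertNthEquiv_symm_apply, Fin.removeNth]
    rw [Fin.sum_univ_succAbove _ i, Fin.forall_iff_succAbove i, and_assoc]
  rw [hpre, (volume_preserving_piFinSuccAbove (fun _ => ℝ) i).measure_preimage
    hAm.nullMeasurableSet]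
  refine (prod_apply_le_mul_of_slice_le volume volume hAm
    (T := Set.univ.pi fun _ => Set.Ioc 0 B) (MeasurableSet.univ_pi fun _ => measurableSet_Ioc)
    (fun p hp => by simpa using hp.2.1) (c := ENNReal.ofReal (2 * η)) fun b _ => ?_).trans ?_
  · refine (measure_mono fun t ht => ?_).trans
      (volume_abs_affine_lt_le (c := c + ∑ l, a (i.succAbove l) * b l) ha hη)
    have h := ht.2.2
    simp only [Set.mem_ofPred_eq]
    convert h using 2
    ring
  · refine (mul_le_mul_right (volume_pi_Ioc_le (by linarith)) _).trans ?_
    rw [← ENNReal.ofReal_mul (by positivity)]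
    apply ENNReal.ofReal_le_ofReal
    have : B ^ n ≤ B ^ (n + 1) := pow_le_pow_right₀ hB (by omega)
    gcongr

/-- The threshold `8 D² η P^{12/(r+1)}` makes the sublevel estimate applicable. -/
lemma sublevel_threshold {m : ℕ} (k : Fin (m + 1)) (A y n : Fin (m + 1) → ℝ)
    (hA : ∀ l, 1 ≤ A l) (hk : ∀ l, A k ≤ A l) {D η : ℝ} (hD : 1 ≤ D) (hη : 0 < η) (hη1 : η ≤ 1)
    (hy : ∀ l, l ≠ k → η ^ 2 ≤ |y k - y l|) (hn : 1 ≤ |n k|) {s : ℝ}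
    (hs : s = 8 * D ^ 2 * η * (∏ l, A l) ^ (12 / ((m + 1 : ℕ) + 1 : ℝ))) :
    4 * η ^ ((m + 1) * (m + 2)) / s
        * (D * A k ^ 4) ^ ((Fintype.card (Fin (m + 1)) : ℝ) - 1 / 2) *
      ∏ l ∈ Finset.univ.erase k, (4 * (D * A l ^ 4) / s) <
        |n k| * ∏ l ∈ Finset.univ.erase k, |y k - y l| := by
  set P := ∏ l, A l with hP
  set Q := P ^ (12 / ((m + 1 : ℕ) + 1 : ℝ)) with hQ
  have hP1 : 1 ≤ P := by
    rw [hP, ← Finset.prod_const_one (s := Finset.univ (α := Fin (m + 1)))]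
    exact Finset.prod_le_prod (fun _ _ => zero_le_one) fun l _ => hA l
  have hQ1 : 1 ≤ Q := Real.one_le_rpow hP1 (by positivity)
  have hs0 : 0 < s := by rw [hs]; positivity
  have hAk : 1 ≤ A k ^ 4 := one_le_pow₀ (hA k)
  have hWk : 1 ≤ D * A k ^ 4 := one_le_mul_of_one_le_of_one_le hD hAk
  have hcard : (Finset.univ.erase k).card = m := by simp
  have hPA : A k ^ (m + 1) ≤ P := by
    have := Finset.prod_le_prod (s := Finset.univ (α := Fin (m + 1))) (f := fun _ => A k)
      (g := A) (fun _ _ => by linarith [hA k]) fun l _ => hk l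
    simpa using this
  have hQr : Q ^ (m + 1) = P ^ (12 * (m + 1) / (m + 2) : ℝ) := by
    rw [hQ, ← Real.rpow_natCast, ← Real.rpow_mul (by linarith)]
    congr 1
    push_cast
    field_simp
    ring
  have hpow : (A k ^ 4) ^ m * P ^ 4 ≤ Q ^ (m + 1) := by
    rw [hQr]
    obtain rfl | hm := Nat.eq_zero_or_pos m
    · have : P ^ 4 = P ^ (4 : ℝ) := by norm_cast
      rw [pow_zero, one_mul, this]
      exact Real.rpow_le_rpow_of_exponent_le hP1 (by norm_num)
    · have h1 : A k ^ m ≤ P := (pow_le_pow_right₀ (hA k) (by omega)).trans hPA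
      calc (A k ^ 4) ^ m * P ^ 4 = (A k ^ m) ^ 4 * P ^ 4 := by ring
        _ ≤ P ^ 4 * P ^ 4 := by
          have := hA k
          gcongr
        _ = P ^ (8 : ℝ) := by rw [← pow_add]; norm_cast
        _ ≤ _ := by
          refine Real.rpow_le_rpow_of_exponent_le hP1 ?_
          have : (1 : ℝ) ≤ m := by exact_mod_cast hm
          rw [le_div_iff₀ (by positivity)]
          linarith
  have hW : (D * A k ^ 4) ^ ((Fintype.card (Fin (m + 1)) : ℝ) - 1 / 2)
      ≤ (D * A k ^ 4) ^ m * (D * A k ^ 4) := by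
    rw [← pow_succ, ← Real.rpow_natCast (D * A k ^ 4)]
    refine Real.rpow_le_rpow_of_exponent_le hWk ?_
    simp
  have hprod : (D * A k ^ 4) * ∏ l ∈ Finset.univ.erase k, (D * A l ^ 4)
      = D ^ (m + 1) * P ^ 4 := by
    rw [Finset.mul_prod_erase Finset.univ (fun l => D * A l ^ 4) (Finset.mem_univ k),
      Finset.prod_mul_distrib, Finset.prod_pow]
    simp [hP]
  have hpe : ∏ l ∈ Finset.univ.erase k, (4 * (D * A l ^ 4) / s)
      = (4 / s) ^ m * ∏ l ∈ Finset.univ.erase k, (D * A l ^ 4) := by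
    have h1 : ∏ _l ∈ Finset.univ.erase k, (4 / s) = (4 / s) ^ m := by
      rw [Finset.prod_const, hcard]
    rw [← h1, ← Finset.prod_mul_distrib]
    exact Finset.prod_congr rfl fun l _ => by ring
  have hpe0 : 0 ≤ ∏ l ∈ Finset.univ.erase k, (D * A l ^ 4) :=
    Finset.prod_nonneg fun l _ => by
      have := hA l
      positivity
  have hR : (η ^ 2) ^ m ≤ |n k| * ∏ l ∈ Finset.univ.erase k, |y k - y l| := by
    have h1 : (η ^ 2) ^ m ≤ ∏ l ∈ Finset.univ.erase k, |y k - y l| := by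
      have h2 : ∏ _l ∈ Finset.univ.erase k, η ^ 2 = (η ^ 2) ^ m := by
        rw [Finset.prod_const, hcard]
      rw [← h2]
      exact Finset.prod_le_prod (fun _ _ => by positivity)
        fun l hl => hy l (Finset.ne_of_mem_erase hl)
    exact h1.trans (le_mul_of_one_le_left (le_trans (by positivity) h1) hn)
  refine lt_of_lt_of_le ?_ hR
  rw [hpe]
  calc 4 * η ^ ((m + 1) * (m + 2)) / s
        * (D * A k ^ 4) ^ ((Fintype.card (Fin (m + 1)) : ℝ) - 1 / 2) *
        ((4 / s) ^ m * ∏ l ∈ Finset.univ.erase k, (D * A l ^ 4))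
      ≤ 4 * η ^ ((m + 1) * (m + 2)) / s * ((D * A k ^ 4) ^ m * (D * A k ^ 4)) *
        ((4 / s) ^ m * ∏ l ∈ Finset.univ.erase k, (D * A l ^ 4)) := by gcongr
    _ = (4 / s) ^ (m + 1) * η ^ ((m + 1) * (m + 2)) * (D * A k ^ 4) ^ m *
        ((D * A k ^ 4) * ∏ l ∈ Finset.univ.erase k, (D * A l ^ 4)) := by ring
    _ = (4 / s) ^ (m + 1) * η ^ ((m + 1) * (m + 2)) * (D ^ m * D ^ (m + 1)) *
        ((A k ^ 4) ^ m * P ^ 4) := by rw [hprod]; ring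
    _ ≤ (4 / s) ^ (m + 1) * η ^ ((m + 1) + 2 * m) * (D ^ (m + 1) * D ^ (m + 1)) *
        Q ^ (m + 1) := by
        have h1 : η ^ ((m + 1) * (m + 2)) ≤ η ^ ((m + 1) + 2 * m) :=
          pow_le_pow_of_le_one hη.le hη1 (by nlinarith)
        have h2 : D ^ m ≤ D ^ (m + 1) := pow_le_pow_right₀ hD (by omega)
        gcongr
    _ = (1 / 2) ^ (m + 1) * (η ^ 2) ^ m := by
        have : 4 / s * η * (D * D) * Q = 1 / 2 := by
          rw [hs]
          field_simp
          norm_num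
        rw [← this]
        ring
    _ < (η ^ 2) ^ m := by
        refine mul_lt_of_lt_one_left (by positivity) ?_
        exact pow_lt_one₀ (by norm_num) (by norm_num) (by omega)

lemma anormSqN_extb_succ {n : ℕ} (b : Fin n → ℝ) (j : Fin (n + 1) → ℕ) :
    anormSqN (n + 1) (extb (n + 1) b) j = (j 0 : ℝ) ^ 2 + ∑ i, b i * (j i.succ : ℝ) ^ 2 := by
  simp [anormSqN, extb, Fin.sum_univ_succ]

lemma one_le_japN {d : ℕ} (j : Fin d → ℕ) : 1 ≤ japN d j := by
  rw [japN, Real.one_le_sqrt]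
  have : 0 ≤ ∑ i, (j i : ℝ) ^ 2 := Finset.sum_nonneg fun _ _ => by positivity
  linarith

lemma anormSqN_extb_nonneg {n : ℕ} {b : Fin n → ℝ} (hb : ∀ i, 0 ≤ b i)
    (j : Fin (n + 1) → ℕ) : 0 ≤ anormSqN (n + 1) (extb (n + 1) b) j := by
  rw [anormSqN_extb_succ]
  exact add_nonneg (by positivity)
    (Finset.sum_nonneg fun i _ => mul_nonneg (hb i) (by positivity))

lemma anormSqN_extb_le {n : ℕ} {b : Fin n → ℝ} {B : ℝ} (hB : 1 ≤ B) (hb : ∀ i, b i ≤ B)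
    (j : Fin (n + 1) → ℕ) :
    anormSqN (n + 1) (extb (n + 1) b) j ≤ B * japN (n + 1) j ^ 2 := by
  rw [anormSqN_extb_succ, japN, Real.sq_sqrt (by positivity), Fin.sum_univ_succ]
  have h1 : ∑ i, b i * (j i.succ : ℝ) ^ 2 ≤ B * ∑ i : Fin n, (j i.succ : ℝ) ^ 2 := by
    rw [Finset.mul_sum]
    exact Finset.sum_le_sum fun i _ => mul_le_mul_of_nonneg_right (hb i) (by positivity)
  nlinarith [sq_nonneg (j 0 : ℝ)]

lemma measurable_anormSqN_extb {n : ℕ} (j : Fin (n + 1) → ℕ) :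
    Measurable fun b : Fin n → ℝ => anormSqN (n + 1) (extb (n + 1) b) j := by
  simp only [anormSqN_extb_succ]
  fun_prop

/-- Nearly resonant parameters form a small set. -/
lemma volume_near_resonance_le {n : ℕ} {B η : ℝ} (hB : 1 ≤ B) (hη : 0 ≤ η) (hη1 : η ≤ 1)
    {j j' : Fin (n + 1) → ℕ} (hj : j ≠ j') :
    volume {b : Fin n → ℝ | (∀ i, b i ∈ Set.Ioc 0 B) ∧
      |anormSqN (n + 1) (extb (n + 1) b) j ^ 2
        - anormSqN (n + 1) (extb (n + 1) b) j' ^ 2| < η ^ 2}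
      ≤ ENNReal.ofReal (2 * η * B ^ n) := by
  set c : Fin (n + 1) → ℤ := fun i => (j i : ℤ) ^ 2 - (j' i : ℤ) ^ 2 with hc
  have hcne : ∀ i, j i ≠ j' i → 1 ≤ |(c i : ℝ)| := fun i hi => by
    have : c i ≠ 0 := fun h => hi <| by
      have h1 : (j i : ℤ) ^ 2 = (j' i : ℤ) ^ 2 := sub_eq_zero.1 h
      exact_mod_cast (pow_left_inj₀ (by positivity) (by positivity) two_ne_zero).1 h1
    exact_mod_cast Int.one_le_abs this
  have hsub : ∀ b : Fin n → ℝ, (∀ i, b i ∈ Set.Ioc 0 B) →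
      |anormSqN (n + 1) (extb (n + 1) b) j ^ 2
        - anormSqN (n + 1) (extb (n + 1) b) j' ^ 2| < η ^ 2 →
      |(c 0 : ℝ) + ∑ i : Fin n, (c i.succ : ℝ) * b i| < η := fun b hb hlt => by
    have h0 := anormSqN_extb_nonneg (fun i => (hb i).1.le) j
    have h0' := anormSqN_extb_nonneg (fun i => (hb i).1.le) j'
    have he : (c 0 : ℝ) + ∑ i : Fin n, (c i.succ : ℝ) * b i
        = anormSqN (n + 1) (extb (n + 1) b) j - anormSqN (n + 1) (extb (n + 1) b) j' := by
      rw [anormSqN_extb_succ, anormSqN_extb_succ, add_sub_add_comm, ← Finset.sum_sub_distrib]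
      simp only [hc]
      push_cast
      congr 1
      exact Finset.sum_congr rfl fun i _ => by ring
    rw [he]
    set p := anormSqN (n + 1) (extb (n + 1) b) j
    set q := anormSqN (n + 1) (extb (n + 1) b) j'
    refine lt_of_pow_lt_pow_left₀ 2 hη (lt_of_le_of_lt ?_ hlt)
    have h1 : |p - q| ≤ |p + q| := by
      rw [abs_of_nonneg (add_nonneg h0 h0')]
      exact abs_le.2 ⟨by linarith, by linarith⟩
    calc |p - q| ^ 2 = |p - q| * |p - q| := by ring
      _ ≤ |p - q| * |p + q| := by gcongr
      _ = |p ^ 2 - q ^ 2| := by rw [← abs_mul]; congr 1; ring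
  by_cases h : ∃ i : Fin n, j i.succ ≠ j' i.succ
  · obtain ⟨i, hi⟩ := h
    refine (measure_mono ?_).trans (volume_slab_le (c := (c 0 : ℝ)) hB hη
      (fun i => (c i.succ : ℝ)) i (hcne _ hi))
    exact fun b hb => ⟨hb.1, hsub b hb.1 hb.2⟩
  · push Not at h
    have h0 : j 0 ≠ j' 0 := fun h0 => hj (funext (Fin.cases h0 h))
    have hz : ∀ i : Fin n, c i.succ = 0 := fun i => by simp [hc, h i]
    refine (measure_mono (t := ∅) fun b hb => ?_).trans (by simp)
    have := hsub b hb.1 hb.2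
    simp only [hz, Int.cast_zero, zero_mul, Finset.sum_const_zero, add_zero] at this
    linarith [hcne 0 h0]

lemma measurableSet_box {n : ℕ} (B : ℝ) :
    MeasurableSet {b : Fin n → ℝ | ∀ i, b i ∈ Set.Ioc 0 B} := by
  have : {b : Fin n → ℝ | ∀ i, b i ∈ Set.Ioc 0 B} = Set.univ.pi fun _ => Set.Ioc 0 B := by
    ext b
    simp
  rw [this]
  exact MeasurableSet.univ_pi fun _ => measurableSet_Ioc

lemma volume_box_le {n : ℕ} {B : ℝ} (hB : 0 ≤ B) :
    volume {b : Fin n → ℝ | ∀ i, b i ∈ Set.Ioc 0 B} ≤ ENNReal.ofReal (B ^ n) := by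
  refine le_trans (measure_mono fun b hb => ?_) (volume_pi_Ioc_le hB)
  simpa using hb

/-- The estimate on the full box `(0, B] × (0, B]ⁿ`, with `γ = η^{r(r+1)}` and `r = m + 1`. -/
lemma volume_good_form_box_le {n m : ℕ} {B : ℝ} (hB : 1 ≤ B)
    (j : Fin (m + 1) → Fin (n + 1) → ℕ) (hj : Function.Injective j)
    (a : Fin (m + 1) → ℝ) (ha : ∀ k, 1 ≤ |a k|) (h : (Fin n → ℝ) → ℝ) (hh : Measurable h)
    {η : ℝ} (hη : 0 < η) (hη1 : η ≤ 1) :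
    volume {p : ℝ × (Fin n → ℝ) | p.1 ∈ Set.Ioc 0 B ∧ (∀ i, p.2 i ∈ Set.Ioc 0 B) ∧
        |h p.2 + ∑ k, a k * Real.sqrt (p.1 + anormSqN (n + 1) (extb (n + 1) p.2) (j k) ^ 2)|
          < η ^ ((m + 1) * (m + 2))}
      ≤ ENNReal.ofReal ((64 * 2 ^ (m + 1) * B ^ (n + 4) + 2 * (m + 1) * B ^ (n + 1)) *
          (η * (∏ k, japN (n + 1) (j k)) ^ (12 / ((m + 1 : ℕ) + 1 : ℝ)))) := by
  set A : Fin (m + 1) → ℝ := fun l => japN (n + 1) (j l) with hA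
  set Q := (∏ k, A k) ^ (12 / ((m + 1 : ℕ) + 1 : ℝ)) with hQ
  obtain ⟨k, -, hk⟩ := Finset.exists_min_image Finset.univ A Finset.univ_nonempty
  have hA1 : ∀ l, 1 ≤ A l := fun l => one_le_japN (j l)
  have hQ1 : 1 ≤ Q := by
    refine Real.one_le_rpow ?_ (by positivity)
    rw [← Finset.prod_const_one (s := Finset.univ (α := Fin (m + 1)))]
    exact Finset.prod_le_prod (fun _ _ => zero_le_one) fun l _ => hA1 l
  set y : (Fin n → ℝ) → Fin (m + 1) → ℝ :=
    fun b l => anormSqN (n + 1) (extb (n + 1) b) (j l) ^ 2 with hy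
  have hym : ∀ l, Measurable fun b => y b l := fun l =>
    (measurable_anormSqN_extb (j l)).pow_const 2
  set D := 2 * B ^ 2 with hD
  have hD1 : 1 ≤ D := by nlinarith
  set s := 8 * D ^ 2 * η * Q with hs
  have hs0 : 0 < s := by positivity
  set box : Set (Fin n → ℝ) := {b | ∀ i, b i ∈ Set.Ioc 0 B} with hbox
  set bad : Fin (m + 1) → Set (Fin n → ℝ) :=
    fun l => {b | (∀ i, b i ∈ Set.Ioc 0 B) ∧ |y b k - y b l| < η ^ 2} with hbad
  have hbadm : ∀ l, MeasurableSet (bad l) := fun l =>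
    (measurableSet_box B).inter
      (measurableSet_lt ((hym k).sub (hym l)).norm measurable_const)
  set S₁ : Set (ℝ × (Fin n → ℝ)) := {p | (p.1 ∈ Set.Ioc 0 B ∧
    |h p.2 + ∑ k, a k * Real.sqrt (p.1 + y p.2 k)| < η ^ ((m + 1) * (m + 2))) ∧
    p.2 ∈ box \ ⋃ l ∈ Finset.univ.erase k, bad l} with hS₁
  have hgm : MeasurableSet (box \ ⋃ l ∈ Finset.univ.erase k, bad l) :=
    (measurableSet_box B).diff (Finset.measurableSet_biUnion _ fun l _ => hbadm l)
  have hS₁m : MeasurableSet S₁ := by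
    have h1 : MeasurableSet {p : ℝ × (Fin n → ℝ) |
        |h p.2 + ∑ k, a k * Real.sqrt (p.1 + y p.2 k)| < η ^ ((m + 1) * (m + 2))} := by
      refine measurableSet_lt (Measurable.norm ((hh.comp measurable_snd).add ?_))
        measurable_const
      exact Finset.measurable_sum _ fun l _ =>
        ((measurable_fst.add ((hym l).comp measurable_snd)).sqrt).const_mul _
    exact ((measurableSet_Ioc.preimage measurable_fst).inter h1).inter
      (hgm.preimage measurable_snd)
  have hcover : {p : ℝ × (Fin n → ℝ) | p.1 ∈ Set.Ioc 0 B ∧ (∀ i, p.2 i ∈ Set.Ioc 0 B) ∧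
        |h p.2 + ∑ k, a k * Real.sqrt (p.1 + anormSqN (n + 1) (extb (n + 1) p.2) (j k) ^ 2)|
          < η ^ ((m + 1) * (m + 2))}
      ⊆ S₁ ∪ Set.Ioc 0 B ×ˢ ⋃ l ∈ Finset.univ.erase k, bad l := by
    rintro p ⟨h1, h2, h3⟩
    by_cases hp : p.2 ∈ ⋃ l ∈ Finset.univ.erase k, bad l
    · exact Or.inr ⟨h1, hp⟩
    · exact Or.inl ⟨⟨h1, h3⟩, h2, hp⟩
  have hv₁ : volume S₁ ≤ ENNReal.ofReal (2 * s * 2 ^ (m + 1) * B ^ n) := by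
    refine (prod_apply_le_mul_of_slice_le volume volume hS₁m hgm (fun p hp => hp.2)
      (c := ENNReal.ofReal (2 * s * 2 ^ (m + 1))) fun b hb => ?_).trans ?_
    · have hy0 : ∀ l, 0 ≤ y b l := fun l => sq_nonneg _
      have hyW : ∀ l, B + y b l ≤ D * A l ^ 4 := fun l => by
        have h0 := anormSqN_extb_nonneg (fun i => (hb.1 i).1.le) (j l)
        have h1 := anormSqN_extb_le hB (fun i => (hb.1 i).2) (j l)
        have h2 : y b l ≤ (B * A l ^ 2) ^ 2 := pow_le_pow_left₀ h0 h1 2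
        have h3 : 1 ≤ A l ^ 4 := one_le_pow₀ (hA1 l)
        have h4 : B ≤ B ^ 2 := le_self_pow₀ hB two_ne_zero
        have h5 : B ≤ B ^ 2 * A l ^ 4 := h4.trans (le_mul_of_one_le_right (by positivity) h3)
        calc B + y b l ≤ B ^ 2 * A l ^ 4 + (B * A l ^ 2) ^ 2 := add_le_add h5 h2
          _ = D * A l ^ 4 := by rw [hD]; ring
      have hfar : ∀ l, l ≠ k → η ^ 2 ≤ |y b k - y b l| := fun l hl => by
        by_contra! hc
        exact hb.2 (Set.mem_biUnion (by simpa using hl) ⟨hb.1, hc⟩)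
      have := volume_sublevel_sqrt_le k (y b) (fun l => D * A l ^ 4) hy0 hs0 hyW a (h b)
        (γ := η ^ ((m + 1) * (m + 2))) (by positivity) ((fun t => (t, b)) ⁻¹' S₁)
        (fun t ht => ht.1.1) (fun t ht => ht.1.2.le)
        (sublevel_threshold k A (y b) a hA1 (fun l => hk l (Finset.mem_univ l)) hD1 hη hη1
          hfar (ha k) hs)
      simpa using this
    · refine (mul_le_mul_right ((measure_mono Set.sdiff_subset).trans
        (volume_box_le (by linarith))) _).trans ?_
      rw [← ENNReal.ofReal_mul (by positivity)]
  have hv₂ : volume (Set.Ioc 0 B ×ˢ ⋃ l ∈ Finset.univ.erase k, bad l)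
      ≤ ENNReal.ofReal (B * (m * (2 * η * B ^ n))) := by
    rw [Measure.volume_eq_prod, Measure.prod_prod, Real.volume_Ioc, sub_zero,
      ENNReal.ofReal_mul (by linarith)]
    refine mul_le_mul_right ((measure_biUnion_finset_le _ _).trans ?_) _
    calc ∑ l ∈ Finset.univ.erase k, volume (bad l)
        ≤ ∑ l ∈ Finset.univ.erase k, ENNReal.ofReal (2 * η * B ^ n) :=
          Finset.sum_le_sum fun l hl => volume_near_resonance_le hB hη.le hη1
            fun he => Finset.ne_of_mem_erase hl (hj he).symm
      _ = ENNReal.ofReal (m * (2 * η * B ^ n)) := by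
          rw [Finset.sum_const, ENNReal.ofReal_mul (Nat.cast_nonneg m), nsmul_eq_mul,
            ENNReal.ofReal_natCast]
          simp only [Finset.mem_univ, Finset.card_erase_of_mem, Finset.card_univ,
            Fintype.card_fin, add_tsub_cancel_right]
  refine (measure_mono hcover).trans ((measure_union_le _ _).trans
    ((add_le_add hv₁ hv₂).trans ?_))
  rw [← ENNReal.ofReal_add (by positivity) (by positivity)]
  apply ENNReal.ofReal_le_ofReal
  have e1 : 2 * s * 2 ^ (m + 1) * B ^ n = 64 * 2 ^ (m + 1) * B ^ (n + 4) * (η * Q) := by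
    rw [hs, hD]; ring
  have e2 : B * (m * (2 * η * B ^ n)) ≤ 2 * (m + 1) * B ^ (n + 1) * (η * Q) := by
    calc B * (m * (2 * η * B ^ n)) = 2 * m * B ^ (n + 1) * (η * 1) := by ring
      _ ≤ _ := by
        gcongr
        linarith
  rw [e1, add_mul]
  linarith

/-- Lemma 2.4, `lem_good_form`: if `I, J` are bounded intervals of
`(0,∞)`, `(j₁,…,j_r) ∈ (ℕ^d)^r` is injective, `n ∈ (ℤ∖{0})^r` and `h : J^{d-1} → ℝ`
is measurable, then for all `γ > 0` the measure of
`{(m,b) ∈ I × J^{d-1} : |h(b) + Σ_k n_k √(m+|j_k|⁴_{(1,b)})| < γ}` is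
`≲_{r,d,I,J} γ^{1/(r(r+1))} (⟨j₁⟩⋯⟨j_r⟩)^{12/(r+1)}`. -/
theorem measure_good_form (d r : ℕ) (hd : 1 ≤ d) (hr : 1 ≤ r)
    (I J : Set ℝ) (hIc : I.OrdConnected) (hJc : J.OrdConnected)
    (hIb : Bornology.IsBounded I) (hJb : Bornology.IsBounded J)
    (hIpos : I ⊆ Set.Ioi 0) (hJpos : J ⊆ Set.Ioi 0) :
    ∃ C : ℝ, 0 < C ∧
      ∀ (j : Fin r → Fin d → ℕ), Function.Injective j →
      ∀ (n : Fin r → ℤ), (∀ k, n k ≠ 0) →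
      ∀ (h : (Fin (d - 1) → ℝ) → ℝ), Measurable h →
      ∀ γ : ℝ, 0 < γ →
        volume {p : ℝ × (Fin (d - 1) → ℝ) |
            p.1 ∈ I ∧ (∀ i, p.2 i ∈ J) ∧
            |h p.2 + ∑ k, (n k : ℝ) *
              Real.sqrt (p.1 + anormSqN d (extb d p.2) (j k) ^ 2)| < γ}
          ≤ ENNReal.ofReal
              (C * γ ^ ((1 : ℝ) / ((r : ℝ) * ((r : ℝ) + 1))) *
                (∏ k, japN d (j k)) ^ ((12 : ℝ) / ((r : ℝ) + 1))) := by
  obtain ⟨n₀, rfl⟩ : ∃ n₀, d = n₀ + 1 := ⟨d - 1, by omega⟩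
  obtain ⟨m, rfl⟩ : ∃ m, r = m + 1 := ⟨r - 1, by omega⟩
  obtain ⟨B₁, hB₁⟩ := hIb.bddAbove
  obtain ⟨B₂, hB₂⟩ := hJb.bddAbove
  set B := max 1 (max B₁ B₂) with hBdef
  have hB : 1 ≤ B := le_max_left _ _
  have hI : I ⊆ Set.Ioc 0 B := fun t ht =>
    ⟨hIpos ht, (hB₁ ht).trans ((le_max_left _ _).trans (le_max_right _ _))⟩
  have hJ : J ⊆ Set.Ioc 0 B := fun t ht =>
    ⟨hJpos ht, (hB₂ ht).trans ((le_max_right _ _).trans (le_max_right _ _))⟩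
  refine ⟨64 * 2 ^ (m + 1) * B ^ (n₀ + 4) + 2 * (m + 1) * B ^ (n₀ + 1), by positivity, ?_⟩
  intro j hj n hn h hh γ hγ
  set e : ℝ := 1 / (((m + 1 : ℕ) : ℝ) * (((m + 1 : ℕ) : ℝ) + 1)) with he
  rcases le_or_gt γ 1 with hγ1 | hγ1
  · have hη : 0 < γ ^ e := Real.rpow_pos_of_pos hγ e
    have hη1 : γ ^ e ≤ 1 := Real.rpow_le_one hγ.le hγ1 (by positivity)
    have hpow : (γ ^ e) ^ ((m + 1) * (m + 2)) = γ := by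
      rw [← Real.rpow_natCast, ← Real.rpow_mul hγ.le]
      have : e * (((m + 1) * (m + 2) : ℕ) : ℝ) = 1 := by
        rw [he]
        push_cast
        field_simp
        ring
      rw [this, Real.rpow_one]
    have key := volume_good_form_box_le hB j hj (fun k => (n k : ℝ))
      (fun k => by exact_mod_cast Int.one_le_abs (hn k)) h hh hη hη1
    rw [hpow] at key
    refine le_trans (measure_mono ?_) (key.trans_eq (by rw [← mul_assoc]))
    exact fun p hp => ⟨hI hp.1, fun i => hJ (hp.2.1 i), hp.2.2⟩
  · have hsub : {p : ℝ × (Fin (n₀ + 1 - 1) → ℝ) | p.1 ∈ I ∧ (∀ i, p.2 i ∈ J) ∧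
            |h p.2 + ∑ k, (n k : ℝ) *
              Real.sqrt (p.1 + anormSqN (n₀ + 1) (extb (n₀ + 1) p.2) (j k) ^ 2)| < γ}
        ⊆ Set.Ioc 0 B ×ˢ {b : Fin n₀ → ℝ | ∀ i, b i ∈ Set.Ioc 0 B} :=
      fun p hp => ⟨hI hp.1, fun i => hJ (hp.2.1 i)⟩
    refine (measure_mono hsub).trans ?_
    have hv : volume (Set.Ioc 0 B ×ˢ {b : Fin n₀ → ℝ | ∀ i, b i ∈ Set.Ioc 0 B})
        ≤ ENNReal.ofReal (B * B ^ n₀) := by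
      rw [Measure.volume_eq_prod, Measure.prod_prod, Real.volume_Ioc, sub_zero,
        ENNReal.ofReal_mul (by linarith)]
      exact mul_le_mul_right (volume_box_le (by linarith)) _
    refine hv.trans (ENNReal.ofReal_le_ofReal ?_)
    have h1 : 1 ≤ γ ^ e := Real.one_le_rpow hγ1.le (by positivity)
    have h2 : 1 ≤ (∏ k, japN (n₀ + 1) (j k)) ^ ((12 : ℝ) / (((m + 1 : ℕ) : ℝ) + 1)) := by
      refine Real.one_le_rpow ?_ (by positivity)
      rw [← Finset.prod_const_one (s := Finset.univ (α := Fin (m + 1)))]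
      exact Finset.prod_le_prod (fun _ _ => zero_le_one) fun l _ => one_le_japN (j l)
    have h3 : B * B ^ n₀ ≤
        64 * 2 ^ (m + 1) * B ^ (n₀ + 4) + 2 * (m + 1) * B ^ (n₀ + 1) := by
      rw [← pow_succ']
      have : 0 < B ^ (n₀ + 1) := by positivity
      have : 0 ≤ (m : ℝ) * B ^ (n₀ + 1) := by positivity
      have : 0 ≤ 64 * 2 ^ (m + 1) * B ^ (n₀ + 4) := by positivity
      linarith
    rw [mul_assoc]
    refine h3.trans (le_mul_of_one_le_right (by positivity) ?_)
    exact one_le_mul_of_one_le_of_one_le h1 h2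

end BeamPaper
end
end

section
/- Fix r ≥ 3, σ ∈ {-1,1}^r with σ₁ = -σ₂, and j₃,…,j_r ∈ ℤ^d; set j_{≥3} := σ₃j₃ + ⋯ + σ_rj_r, and for j₁ ∈ ℤ^d set j₂ := j₁ + σ₁ j_{≥3} and g_{j₁}(a) := Σ_{k=1}^r σ_k √(1 + |j_k|⁴_a). Let I := { i ∈ {1,…,d} : j_{≥3,i} ≠ 0 } and C_i := { j₁ ∈ ℤ^d : |j_{1,i}| ≥ 2(1 + Σ_{k=3}^r |j_{k,i}|²) }. Then for every i ∈ I and every γ > 0, the Lebesgue measure of { a ∈ (1,4)^d : ∃ j₁ ∈ C_i with |g_{j₁}(a)| < γ |j₁|^{-(d-1)} (log |j₁|)^{-2d} } is ≲_d γ. -/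
open MeasureTheory
open scoped BigOperators

noncomputable section

namespace BeamPaper

abbrev Idx (d : ℕ) := Fin d → ℤ
def jnormSq (d : ℕ) (j : Idx d) : ℝ := ∑ i, ((j i : ℝ)) ^ 2
def enorm (d : ℕ) (j : Idx d) : ℝ := Real.sqrt (jnormSq d j)
def jap (d : ℕ) (j : Idx d) : ℝ := Real.sqrt (1 + jnormSq d j)
def anormSq (d : ℕ) (a : Fin d → ℝ) (j : Idx d) : ℝ := ∑ i, a i * (j i : ℝ) ^ 2
def omg (d : ℕ) (a : Fin d → ℝ) (j : Idx d) : ℝ := Real.sqrt (1 + anormSq d a j ^ 2)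
def prodTail (d : ℕ) {r : ℕ} (j : Fin r → Idx d) : ℝ :=
  ∏ i : Fin r, if 2 ≤ (i : ℕ) then jap d (j i) else 1
def box (d : ℕ) : Set (Fin d → ℝ) := Set.univ.pi fun _ => Set.Ioo (1 : ℝ) 4

def IsResonant {d r : ℕ} (σ : Fin r → ℤ) (j : Fin r → Idx d) : Prop :=
  Even r ∧ ∃ ρ : Equiv.Perm (Fin r),
    (∀ i, ρ (ρ i) = i) ∧ (∀ i, ρ i ≠ i) ∧
      ∀ i, (∀ l, |j (ρ i) l| = |j i l|) ∧ σ (ρ i) = - σ i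

/-- The non-resonance property of the parameter `a` established in Proposition 2.2
(`mainNR`) of the paper: lower bounds on the small divisors `Σ σ_k ω_{j_k}`,
outside resonant couples. -/
def GoodParam (d : ℕ) (a : Fin d → ℝ) : Prop :=
  ∃ γ : ℝ, 0 < γ ∧ ∃ c : ℕ → ℝ, ∃ C : ℕ → ℝ → ℝ,
    (∀ r, 0 < c r) ∧ (∀ r δ, 0 < C r δ) ∧
      ∀ (r : ℕ) (_hr : 3 ≤ r) (δ : ℝ), 0 < δ →
        ∀ (σ : Fin r → ℤ) (j : Fin r → Idx d),
          (∀ i, σ i = 1 ∨ σ i = -1) →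
          (∑ i, σ i • j i) = 0 →
          (∀ i i' : Fin r, i ≤ i' → enorm d (j i') ≤ enorm d (j i)) →
          ¬ IsResonant σ j →
          (σ ⟨0, by omega⟩ * σ ⟨1, by omega⟩ = 1 →
            c r * (γ * prodTail d j ^ (-(9 * (d : ℝ) * (r : ℝ) ^ 2))) ≤
              |∑ k, (σ k : ℝ) * omg d a (j k)|) ∧
          (σ ⟨0, by omega⟩ * σ ⟨1, by omega⟩ = -1 →
            C r δ * (γ * jap d (j ⟨0, by omega⟩) ^ (-((d : ℝ) - 1 + δ)) *
              prodTail d j ^ (-(44 * (d : ℝ) * (r : ℝ) ^ 4))) ≤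
              |∑ k, (σ k : ℝ) * omg d a (j k)|)

/-- `j_{≥3} = σ₃ j₃ + ⋯ + σ_r j_r` (0-based: indices `k ≥ 2`). -/
def jge3 (d r : ℕ) (σ : Fin r → ℤ) (jt : Fin r → Idx d) : Idx d :=
  fun l => ∑ k : Fin r, if 2 ≤ (k : ℕ) then σ k * jt k l else 0

/-- `j₂ := j₁ + σ₁ j_{≥3}`. -/
def j2of (d r : ℕ) (hr : 3 ≤ r) (σ : Fin r → ℤ) (jt : Fin r → Idx d) (j1 : Idx d) : Idx d :=
  fun l => j1 l + σ ⟨0, by omega⟩ * jge3 d r σ jt l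

/-- The family `(j₁, j₂, j₃, …, j_r)`. -/
def Jfam (d r : ℕ) (hr : 3 ≤ r) (σ : Fin r → ℤ) (jt : Fin r → Idx d) (j1 : Idx d) :
    Fin r → Idx d :=
  fun k => if (k : ℕ) = 0 then j1 else if (k : ℕ) = 1 then j2of d r hr σ jt j1 else jt k

/-- `g_{j₁}(a) = Σ_k σ_k √(1+|j_k|_a⁴)`. -/
def gfun (d r : ℕ) (hr : 3 ≤ r) (σ : Fin r → ℤ) (jt : Fin r → Idx d) (j1 : Idx d)
    (a : Fin d → ℝ) : ℝ :=
  ∑ k, (σ k : ℝ) * omg d a (Jfam d r hr σ jt j1 k)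

/-- `⟨j₃⟩⋯⟨j_r⟩` in terms of the tail data. -/
def tailProd (d r : ℕ) (jt : Fin r → Idx d) : ℝ :=
  ∏ k : Fin r, if 2 ≤ (k : ℕ) then jap d (jt k) else 1


section OneVariable

lemma abs_sqrt_one_add_sq_sub_le (A B : ℝ) :
    |√(1 + A ^ 2) - √(1 + B ^ 2)| ≤ |A - B| := by
  have hu : √(1 + A ^ 2) ^ 2 = 1 + A ^ 2 := Real.sq_sqrt (by positivity)
  have hv : √(1 + B ^ 2) ^ 2 = 1 + B ^ 2 := Real.sq_sqrt (by positivity)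
  have hA : |A| ≤ √(1 + A ^ 2) := Real.abs_le_sqrt (by linarith)
  have hB : |B| ≤ √(1 + B ^ 2) := Real.abs_le_sqrt (by linarith)
  have hpos : 0 < √(1 + A ^ 2) + √(1 + B ^ 2) := by positivity
  refine le_of_mul_le_mul_right ?_ hpos
  calc |√(1 + A ^ 2) - √(1 + B ^ 2)| * (√(1 + A ^ 2) + √(1 + B ^ 2))
      = |(√(1 + A ^ 2) - √(1 + B ^ 2)) * (√(1 + A ^ 2) + √(1 + B ^ 2))| := by
        rw [abs_mul, abs_of_pos hpos]
    _ = |(A - B) * (A + B)| := by congr 1; linear_combination hu - hv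
    _ = |A - B| * |A + B| := abs_mul _ _
    _ ≤ |A - B| * (√(1 + A ^ 2) + √(1 + B ^ 2)) := by
        gcongr
        exact (abs_add_le A B).trans (add_le_add hA hB)

lemma abs_sqrt_one_add_sq_sub_sub_le {A B N : ℝ} (hN : 0 < N) (hA : N ≤ A) (hB : N ≤ B) :
    2 * N ^ 2 * |√(1 + A ^ 2) - √(1 + B ^ 2) - (A - B)| ≤ |A - B| := by
  have hlip := abs_sqrt_one_add_sq_sub_le A B
  have hu : √(1 + A ^ 2) ^ 2 = 1 + A ^ 2 := Real.sq_sqrt (by positivity)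
  have hv : √(1 + B ^ 2) ^ 2 = 1 + B ^ 2 := Real.sq_sqrt (by positivity)
  have hAu : A ≤ √(1 + A ^ 2) := (le_abs_self A).trans (Real.abs_le_sqrt (by linarith))
  have hBv : B ≤ √(1 + B ^ 2) := (le_abs_self B).trans (Real.abs_le_sqrt (by linarith))
  set u := √(1 + A ^ 2)
  set v := √(1 + B ^ 2)
  have hp : (u - A) * (u + A) = 1 := by linear_combination hu
  have hq : (v - B) * (v + B) = 1 := by linear_combination hv
  have hp' : (u - A) * (2 * N) ≤ 1 := by
    rw [← hp]; exact mul_le_mul_of_nonneg_left (by linarith) (by linarith)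
  have hq' : (v - B) * (2 * N) ≤ 1 := by
    rw [← hq]; exact mul_le_mul_of_nonneg_left (by linarith) (by linarith)
  have hpq0 : 0 ≤ (u - A) * (v - B) := mul_nonneg (by linarith) (by linarith)
  have hpq : ((u - A) * (2 * N)) * ((v - B) * (2 * N)) ≤ 1 :=
    mul_le_one₀ hp' (mul_nonneg (by linarith) (by linarith)) hq'
  have key : u - v - (A - B) = (u - A) * (v - B) * ((v - u) - (A - B)) := by
    linear_combination (v - B) * hp - (u - A) * hq
  have h2 : |(v - u) - (A - B)| ≤ 2 * |A - B| := by
    have := abs_sub (v - u) (A - B)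
    rw [abs_sub_comm v u] at this
    linarith
  rw [key, abs_mul, abs_of_nonneg hpq0]
  have h3 : (4 * N ^ 2 * ((u - A) * (v - B))) * |(v - u) - (A - B)| ≤ 1 * (2 * |A - B|) :=
    mul_le_mul (by linarith) h2 (abs_nonneg _) zero_le_one
  linarith

lemma volume_inter_abs_lt_le {F : ℝ → ℝ} {s : Set ℝ} {m ε : ℝ} (hm : 0 < m)
    (hF : ∀ x ∈ s, ∀ y ∈ s, m * |x - y| ≤ |F x - F y|) :
    volume {x | x ∈ s ∧ |F x| < ε} ≤ ENNReal.ofReal (2 * ε / m) := by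
  refine (Real.volume_le_diam _).trans (Metric.ediam_le ?_)
  rintro x ⟨hx, hxε⟩ y ⟨hy, hyε⟩
  rw [edist_dist, Real.dist_eq]
  refine ENNReal.ofReal_le_ofReal ?_
  rw [le_div_iff₀ hm]
  have := hF x hx y hy
  have := abs_sub (F x) (F y)
  linarith

end OneVariable

section Monotonicity

lemma anormSq_sub_of_eq_off {d : ℕ} {a b : Fin d → ℝ} {i : Fin d}
    (hab : ∀ l, l ≠ i → a l = b l) (j : Idx d) :
    anormSq d a j - anormSq d b j = (a i - b i) * (j i : ℝ) ^ 2 := by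
  unfold anormSq
  rw [← Finset.sum_sub_distrib, Finset.sum_eq_single i]
  · ring
  · intro l _ hl
    rw [hab l hl, sub_self]
  · simp

lemma sq_le_anormSq {d : ℕ} {a : Fin d → ℝ} (ha : ∀ l, 1 ≤ a l) (j : Idx d) (i : Fin d) :
    (j i : ℝ) ^ 2 ≤ anormSq d a j := by
  have h : ∀ l, (j l : ℝ) ^ 2 ≤ a l * (j l : ℝ) ^ 2 := fun l =>
    le_mul_of_one_le_left (sq_nonneg _) (ha l)
  refine (h i).trans (Finset.single_le_sum (f := fun l => a l * (j l : ℝ) ^ 2)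
    (fun l _ => (sq_nonneg _).trans (h l)) (Finset.mem_univ i))

lemma abs_omg_sub_le {d : ℕ} {a b : Fin d → ℝ} {i : Fin d}
    (hab : ∀ l, l ≠ i → a l = b l) (j : Idx d) :
    |omg d a j - omg d b j| ≤ |a i - b i| * (j i : ℝ) ^ 2 := by
  refine (abs_sqrt_one_add_sq_sub_le _ _).trans_eq ?_
  rw [anormSq_sub_of_eq_off hab, abs_mul, abs_of_nonneg (sq_nonneg (j i : ℝ))]

lemma abs_omg_sub_sub_le {d : ℕ} {a b : Fin d → ℝ} {i : Fin d}
    (ha : ∀ l, 1 ≤ a l) (hb : ∀ l, 1 ≤ b l) (hab : ∀ l, l ≠ i → a l = b l)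
    (j : Idx d) (hj : j i ≠ 0) :
    2 * |omg d a j - omg d b j - (a i - b i) * (j i : ℝ) ^ 2| ≤ |a i - b i| := by
  have h1 : (1 : ℝ) ≤ (j i : ℝ) ^ 2 := by
    exact_mod_cast Int.add_one_le_iff.mpr (by positivity : 0 < (j i) ^ 2)
  have h := abs_sqrt_one_add_sq_sub_sub_le (lt_of_lt_of_le one_pos h1)
    (sq_le_anormSq ha j i) (sq_le_anormSq hb j i)
  rw [anormSq_sub_of_eq_off hab, abs_mul, abs_of_nonneg (sq_nonneg (j i : ℝ))] at h
  change 2 * ((j i : ℝ) ^ 2) ^ 2 * |omg d a j - omg d b j - (a i - b i) * (j i : ℝ) ^ 2| ≤ _ at h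
  set N := (j i : ℝ) ^ 2
  set X := |omg d a j - omg d b j - (a i - b i) * N|
  have hX : 0 ≤ X := abs_nonneg _
  refine le_of_mul_le_mul_right ?_ (lt_of_lt_of_le one_pos h1)
  have : X * N * 1 ≤ X * N * N := mul_le_mul_of_nonneg_left h1 (by positivity)
  linarith

lemma sum_eq_add_add_sum_two_le {r : ℕ} (hr : 3 ≤ r) {M : Type*} [AddCommMonoid M]
    (f : Fin r → M) :
    ∑ k, f k = f ⟨0, by omega⟩ + (f ⟨1, by omega⟩ +
      ∑ k : Fin r, if 2 ≤ (k : ℕ) then f k else 0) := by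
  obtain ⟨s, rfl⟩ : ∃ s, r = s + 2 := ⟨r - 2, by omega⟩
  simp only [Fin.sum_univ_succ]
  simp

lemma gfun_eq {d r : ℕ} (hr : 3 ≤ r) (σ : Fin r → ℤ) (jt : Fin r → Idx d) (j1 : Idx d)
    (a : Fin d → ℝ) :
    gfun d r hr σ jt j1 a = (σ ⟨0, by omega⟩ : ℝ) * omg d a j1 +
      ((σ ⟨1, by omega⟩ : ℝ) * omg d a (j2of d r hr σ jt j1) +
        ∑ k : Fin r, if 2 ≤ (k : ℕ) then (σ k : ℝ) * omg d a (jt k) else 0) := by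
  rw [gfun, sum_eq_add_add_sum_two_le hr]
  congr 2
  refine Finset.sum_congr rfl fun k _ => ?_
  split_ifs with hk
  · rw [Jfam, if_neg (by omega), if_neg (by omega)]
  · rfl

lemma abs_jge3_le {d r : ℕ} {σ : Fin r → ℤ} (hσ : ∀ k, σ k = 1 ∨ σ k = -1)
    (jt : Fin r → Idx d) (i : Fin d) :
    |jge3 d r σ jt i| ≤ ∑ k : Fin r, if 2 ≤ (k : ℕ) then (jt k i) ^ 2 else 0 := by
  refine (Finset.abs_sum_le_sum_abs _ _).trans (Finset.sum_le_sum fun k _ => ?_)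
  split_ifs
  · have : |σ k * jt k i| = |jt k i| := by
      rcases hσ k with h | h <;> simp [h]
    rw [this, ← sq_abs]
    exact Int.le_self_sq _
  · simp

lemma abs_tail_sub_le {d r : ℕ} {σ : Fin r → ℤ} (hσ : ∀ k, σ k = 1 ∨ σ k = -1)
    (jt : Fin r → Idx d) {a b : Fin d → ℝ} {i : Fin d} (hab : ∀ l, l ≠ i → a l = b l) :
    |(∑ k : Fin r, if 2 ≤ (k : ℕ) then (σ k : ℝ) * omg d a (jt k) else 0) -
      ∑ k : Fin r, if 2 ≤ (k : ℕ) then (σ k : ℝ) * omg d b (jt k) else 0| ≤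
      |a i - b i| * ((∑ k : Fin r, if 2 ≤ (k : ℕ) then (jt k i) ^ 2 else 0 : ℤ) : ℝ) := by
  rw [← Finset.sum_sub_distrib, Int.cast_sum, Finset.mul_sum]
  refine (Finset.abs_sum_le_sum_abs _ _).trans (Finset.sum_le_sum fun k _ => ?_)
  split_ifs
  · have h1 : |(σ k : ℝ)| = 1 := by rcases hσ k with h | h <;> simp [h]
    rw [← mul_sub, abs_mul, h1, one_mul]
    exact_mod_cast abs_omg_sub_le hab (jt k)
  · simp

lemma le_abs_sq_sub_sq {m n S : ℤ} (hn : n ≠ 0) (hnS : |n| ≤ S) (hm : 2 * (1 + S) ≤ |m|) :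
    |m| + S + 1 ≤ |m ^ 2 - (m + n) ^ 2| := by
  have h1 : m ^ 2 - (m + n) ^ 2 = -(n * (2 * m + n)) := by ring
  have h2 : 1 ≤ |n| := Int.one_le_abs hn
  have h3 : 2 * |m| - |n| ≤ |2 * m + n| := by
    have := abs_sub_abs_le_abs_add (2 * m) n
    rwa [abs_mul, abs_two] at this
  rw [h1, abs_neg, abs_mul]
  nlinarith [abs_nonneg (2 * m + n)]

/-- Along the `i`-th coordinate direction, `g_{j₁}` is expanding by a factor `|j_{1,i}|`. -/
lemma mul_abs_sub_le_abs_gfun_sub {d r : ℕ} (hr : 3 ≤ r) {σ : Fin r → ℤ}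
    (hσ : ∀ k, σ k = 1 ∨ σ k = -1) (hσ01 : σ ⟨0, by omega⟩ = - σ ⟨1, by omega⟩)
    (jt : Fin r → Idx d) {i : Fin d} (hi : jge3 d r σ jt i ≠ 0) {j1 : Idx d}
    (hj1 : 2 * (1 + ∑ k : Fin r, if 2 ≤ (k : ℕ) then (jt k i) ^ 2 else 0) ≤ |j1 i|)
    {a b : Fin d → ℝ} (ha : ∀ l, 1 ≤ a l) (hb : ∀ l, 1 ≤ b l)
    (hab : ∀ l, l ≠ i → a l = b l) :
    |(j1 i : ℝ)| * |a i - b i| ≤ |gfun d r hr σ jt j1 a - gfun d r hr σ jt j1 b| := by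
  have hS := abs_jge3_le hσ jt i
  have htail := abs_tail_sub_le hσ jt hab
  rw [gfun_eq, gfun_eq]
  set S : ℤ := ∑ k : Fin r, if 2 ≤ (k : ℕ) then (jt k i) ^ 2 else 0
  set Ta := ∑ k : Fin r, if 2 ≤ (k : ℕ) then (σ k : ℝ) * omg d a (jt k) else 0
  set Tb := ∑ k : Fin r, if 2 ≤ (k : ℕ) then (σ k : ℝ) * omg d b (jt k) else 0
  have hj2 : j2of d r hr σ jt j1 i = j1 i + σ ⟨0, by omega⟩ * jge3 d r σ jt i := rfl
  set j2 := j2of d r hr σ jt j1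
  set n := σ ⟨0, by omega⟩ * jge3 d r σ jt i
  have hσ0 := hσ ⟨0, by omega⟩
  have hnabs : |n| = |jge3 d r σ jt i| := by
    rcases hσ0 with h | h <;> simp [n, h]
  have hn0 : n ≠ 0 := abs_pos.mp (hnabs ▸ abs_pos.mpr hi)
  have hnS : |n| ≤ S := hnabs ▸ hS
  have hn1 := Int.one_le_abs hn0
  have hj10 : j1 i ≠ 0 := abs_pos.mp (by omega)
  have hj20 : j2 i ≠ 0 := by
    intro h
    have : |j1 i| = |n| := by rw [← abs_neg n]; congr 1; omega
    omega
  have e1 := abs_omg_sub_sub_le ha hb hab j1 hj10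
  have e2 := abs_omg_sub_sub_le ha hb hab j2 hj20
  have hsq := le_abs_sq_sub_sq hn0 hnS hj1
  rw [← hj2] at hsq
  have hsq' : |(j1 i : ℝ)| + S + 1 ≤ |(j1 i : ℝ) ^ 2 - (j2 i : ℝ) ^ 2| := by exact_mod_cast hsq
  have hmain : |a i - b i| * (|(j1 i : ℝ)| + S + 1) ≤
      |(a i - b i) * (j1 i : ℝ) ^ 2 - (a i - b i) * (j2 i : ℝ) ^ 2| := by
    rw [← mul_sub, abs_mul]
    gcongr
  have hσ0' : |(σ ⟨0, by omega⟩ : ℝ)| = 1 := by rcases hσ0 with h | h <;> simp [h]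
  have hσ1 : (σ ⟨1, by omega⟩ : ℝ) = - (σ ⟨0, by omega⟩ : ℝ) := by rw [hσ01]; push_cast; ring
  rw [hσ1]
  set s : ℝ := (σ ⟨0, by omega⟩ : ℝ)
  set A1 := omg d a j1 - omg d b j1
  set A2 := omg d a j2 - omg d b j2
  have hA : |A1 - A2| ≤ |s * omg d a j1 + (-s * omg d a j2 + Ta) -
      (s * omg d b j1 + (-s * omg d b j2 + Tb))| + |Ta - Tb| := by
    have : s * (A1 - A2) = (s * omg d a j1 + (-s * omg d a j2 + Ta) -
      (s * omg d b j1 + (-s * omg d b j2 + Tb))) - (Ta - Tb) := by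
      simp only [A1, A2]; ring
    calc |A1 - A2| = |s * (A1 - A2)| := by rw [abs_mul, hσ0', one_mul]
      _ ≤ _ := by rw [this]; exact abs_sub _ _
  set P1 := (a i - b i) * (j1 i : ℝ) ^ 2
  set P2 := (a i - b i) * (j2 i : ℝ) ^ 2
  have hP : |P1 - P2| ≤ |A1 - A2| + |A1 - P1| + |A2 - P2| := by
    have : P1 - P2 = (A1 - A2) - (A1 - P1) + (A2 - P2) := by ring
    rw [this]
    exact (abs_add_le _ _).trans (by gcongr; exact abs_sub _ _)
  linarith

end Monotonicity

section Summation

/-- A summable one-dimensional majorant of order `1 / (|m| (log |m|)²)`. -/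
def logWeight (m : ℤ) : ℝ :=
  (max 1 |(m : ℝ)|)⁻¹ * (Real.log (max 4 |(m : ℝ)|) ^ 2)⁻¹

lemma log_max_four_pos (x : ℝ) : 0 < Real.log (max 4 x) :=
  Real.log_pos (lt_of_lt_of_le (by norm_num) (le_max_left 4 x))

lemma logWeight_nonneg (m : ℤ) : 0 ≤ logWeight m := by
  unfold logWeight
  positivity

lemma inv_mul_inv_log_sq_le_logWeight {m : ℤ} {x y : ℝ} (hx : max 1 |(m : ℝ)| ≤ x)
    (hy : max 4 |(m : ℝ)| ≤ y) : x⁻¹ * (Real.log y ^ 2)⁻¹ ≤ logWeight m := by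
  have h1 := log_max_four_pos |(m : ℝ)|
  have h2 : (0 : ℝ) < max 1 |(m : ℝ)| := lt_of_lt_of_le one_pos (le_max_left _ _)
  have h3 : (0 : ℝ) < max 4 |(m : ℝ)| := lt_of_lt_of_le (by norm_num) (le_max_left _ _)
  unfold logWeight
  gcongr

lemma summable_logWeight : Summable logWeight := by
  have hnat : Summable fun n : ℕ => logWeight (n : ℤ) := by
    rw [← summable_condensed_iff_of_nonneg (fun n => logWeight_nonneg _)]
    · have hs : Summable fun k : ℕ => (Real.log 2 ^ 2)⁻¹ * (1 / (k : ℝ) ^ 2) :=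
        (Real.summable_one_div_nat_pow.mpr one_lt_two).mul_left _
      refine hs.of_norm_bounded_eventually_nat ?_
      filter_upwards [Filter.eventually_ge_atTop 2] with k hk
      have h4 : (4 : ℝ) ≤ 2 ^ k := by
        calc (4 : ℝ) = 2 ^ 2 := by norm_num
          _ ≤ 2 ^ k := pow_le_pow_right₀ one_le_two hk
      have habs : |(((2 ^ k : ℕ) : ℤ) : ℝ)| = 2 ^ k := by
        push_cast
        exact abs_of_pos (by positivity)
      rw [Real.norm_of_nonneg (mul_nonneg (by positivity) (logWeight_nonneg _)), logWeight, habs,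
        max_eq_right (by linarith), max_eq_right h4, Real.log_pow]
      refine le_of_eq ?_
      field_simp
    · intro m n _ hmn
      have : |((m : ℤ) : ℝ)| ≤ |((n : ℤ) : ℝ)| := by
        simpa using hmn
      exact inv_mul_inv_log_sq_le_logWeight (max_le_max_left _ this) (max_le_max_left _ this)
  refine Summable.of_nat_of_neg hnat (hnat.congr fun n => ?_)
  simp [logWeight]

lemma tsum_prod_eq_tsum_pow (h : ℤ → ENNReal) (d : ℕ) :
    ∑' j : Fin d → ℤ, ∏ l, h (j l) = (∑' m, h m) ^ d := by
  induction d with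
  | zero => simp
  | succ d ih =>
    rw [← (Fin.consEquiv fun _ : Fin (d + 1) => ℤ).tsum_eq]
    simp only [Fin.consEquiv_apply, Fin.prod_univ_succ, Fin.cons_zero, Fin.cons_succ]
    rw [ENNReal.tsum_prod (f := fun (m : ℤ) (j : Fin d → ℤ) => h m * ∏ l, h (j l))]
    simp_rw [ENNReal.tsum_mul_left, ih, ENNReal.tsum_mul_right]
    rw [pow_succ']

lemma abs_le_enorm {d : ℕ} (j : Idx d) (l : Fin d) : |(j l : ℝ)| ≤ enorm d j := by
  refine Real.abs_le_sqrt ?_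
  exact Finset.single_le_sum (f := fun l => (j l : ℝ) ^ 2) (fun _ _ => sq_nonneg _)
    (Finset.mem_univ l)

lemma enorm_rpow_mul_log_rpow_div_le_prod {n : ℕ} (j : Idx (n + 1)) {i : Fin (n + 1)}
    (hi : 4 ≤ |(j i : ℝ)|) :
    enorm (n + 1) j ^ (-(((n + 1 : ℕ) : ℝ) - 1)) *
      Real.log (enorm (n + 1) j) ^ (-(2 * ((n + 1 : ℕ) : ℝ))) / |(j i : ℝ)| ≤
      ∏ l, logWeight (j l) := by
  have hE : ∀ l, |(j l : ℝ)| ≤ enorm (n + 1) j := abs_le_enorm j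
  set E := enorm (n + 1) j
  have hE4 : 4 ≤ E := hi.trans (hE i)
  have hL : 0 < Real.log E := Real.log_pos (by linarith)
  have e1 : E ^ (-(((n + 1 : ℕ) : ℝ) - 1)) = (E⁻¹) ^ n := by
    rw [Nat.cast_succ, add_sub_cancel_right, Real.rpow_neg (by linarith), Real.rpow_natCast,
      inv_pow]
  have e2 : Real.log E ^ (-(2 * ((n + 1 : ℕ) : ℝ))) =
      ((Real.log E ^ 2)⁻¹) ^ n * (Real.log E ^ 2)⁻¹ := by
    rw [Real.rpow_neg hL.le, ← pow_succ, inv_pow, ← pow_mul, ← Real.rpow_natCast]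
    push_cast
    rfl
  have e3 : ∏ _l : Fin n, (E⁻¹ * (Real.log E ^ 2)⁻¹) = (E⁻¹) ^ n * ((Real.log E ^ 2)⁻¹) ^ n := by
    simp [mul_pow]
  rw [e1, e2, Fin.prod_univ_succAbove _ i]
  calc (E⁻¹) ^ n * (((Real.log E ^ 2)⁻¹) ^ n * (Real.log E ^ 2)⁻¹) / |(j i : ℝ)|
      = (|(j i : ℝ)|⁻¹ * (Real.log E ^ 2)⁻¹) * ∏ _l : Fin n, (E⁻¹ * (Real.log E ^ 2)⁻¹) := by
        rw [e3]; ring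
    _ ≤ logWeight (j i) * ∏ l : Fin n, logWeight (j (i.succAbove l)) := by
        refine mul_le_mul
          (inv_mul_inv_log_sq_le_logWeight (max_le (by linarith) le_rfl) (max_le hE4 (hE i)))
          (Finset.prod_le_prod (fun _ _ => by positivity) fun l _ =>
            inv_mul_inv_log_sq_le_logWeight (max_le (by linarith) (hE _)) (max_le hE4 (hE _)))
          (Finset.prod_nonneg fun _ _ => by positivity) (logWeight_nonneg _)

end Summation

section Slicing

lemma continuous_gfun {d r : ℕ} (hr : 3 ≤ r) (σ : Fin r → ℤ) (jt : Fin r → Idx d) (j1 : Idx d) :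
    Continuous (gfun d r hr σ jt j1) := by
  unfold gfun omg anormSq
  fun_prop

lemma measurableSet_box_s5 (d : ℕ) : MeasurableSet (box d) :=
  MeasurableSet.univ_pi fun _ => measurableSet_Ioo

lemma volume_box (d : ℕ) : volume (box d) = 3 ^ d := by
  rw [box, Real.volume_pi_Ioo]
  norm_num

/-- A function on the box that expands along one coordinate direction has small sublevel sets. -/
lemma volume_box_inter_abs_lt_le {n : ℕ} {G : (Fin (n + 1) → ℝ) → ℝ} (hG : Measurable G)
    (i : Fin (n + 1)) {m ε : ℝ} (hm : 0 < m)
    (hexp : ∀ a ∈ box (n + 1), ∀ b ∈ box (n + 1), (∀ l, l ≠ i → a l = b l) →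
      m * |a i - b i| ≤ |G a - G b|) :
    volume {a | a ∈ box (n + 1) ∧ |G a| < ε} ≤ 3 ^ n * ENNReal.ofReal (2 * ε / m) := by
  have hA : MeasurableSet {a | a ∈ box (n + 1) ∧ |G a| < ε} :=
    (measurableSet_box_s5 _).inter (measurableSet_lt (continuous_abs.measurable.comp hG) measurable_const)
  have hmp := (volume_preserving_piFinSuccAbove (fun _ : Fin (n + 1) => ℝ) i).symm
  rw [← hmp.measure_preimage hA.nullMeasurableSet]
  have hA' := hmp.measurable hA
  rw [Measure.volume_eq_prod, Measure.prod_apply_symm hA']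
  calc _ ≤ ∫⁻ y : Fin n → ℝ, (box n).indicator (fun _ => ENNReal.ofReal (2 * ε / m)) y := by
        refine lintegral_mono fun y => ?_
        by_cases hy : y ∈ box n
        · rw [Set.indicator_of_mem hy]
          refine volume_inter_abs_lt_le (s := {x | i.insertNth x y ∈ box (n + 1)})
            (F := fun x => G (i.insertNth x y)) hm fun x hx x' hx' => ?_
          have := hexp _ hx _ hx' fun l hl => ?_
          · simpa using this
          · obtain ⟨k, rfl⟩ := Fin.exists_succAbove_eq hl
            simp
        · rw [Set.indicator_of_notMem hy]
          refine le_of_eq ?_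
          convert measure_empty (μ := (volume : Measure ℝ))
          refine Set.eq_empty_of_forall_notMem fun x hx => hy fun l _ => ?_
          have := hx.1 (i.succAbove l) trivial
          simpa using this
    _ = 3 ^ n * ENNReal.ofReal (2 * ε / m) := by
        rw [lintegral_indicator_const (measurableSet_box_s5 n), volume_box, mul_comm]

end Slicing

/-- Corollary 2.7, `cor_gen_nice`: for every `i` with `j_{≥3,i} ≠ 0`
and every `γ > 0`, the measure of the set of `a ∈ (1,4)^d` for which there exists
`j₁ ∈ C_i` with `|g_{j₁}(a)| < γ |j₁|^{-(d-1)} (log|j₁|)^{-2d}` is `≲_d γ`. -/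
theorem measure_exceptional_Ci_le (d : ℕ) :
    ∃ C : ℝ, 0 < C ∧
      ∀ (r : ℕ) (hr : 3 ≤ r) (σ : Fin r → ℤ),
        (∀ i, σ i = 1 ∨ σ i = -1) →
        σ ⟨0, by omega⟩ = - σ ⟨1, by omega⟩ →
        ∀ (jt : Fin r → Idx d) (i : Fin d),
          jge3 d r σ jt i ≠ 0 →
          ∀ γ : ℝ, 0 < γ →
            volume {a : Fin d → ℝ | a ∈ box d ∧
                ∃ j1 : Idx d,
                  (2 * (1 + ∑ k : Fin r, if 2 ≤ (k : ℕ) then (jt k i) ^ 2 else 0) ≤ |j1 i|) ∧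
                  |gfun d r hr σ jt j1 a| <
                    γ * enorm d j1 ^ (-((d : ℝ) - 1)) *
                      Real.log (enorm d j1) ^ (-(2 * (d : ℝ)))}
              ≤ ENNReal.ofReal (C * γ) := by
  obtain _ | n := d
  · exact ⟨1, one_pos, fun _ _ _ _ _ _ i => i.elim0⟩
  set K : ENNReal := ∑' m, ENNReal.ofReal (logWeight m)
  have hK : K ≠ ⊤ := summable_logWeight.tsum_ofReal_ne_top
  have hB : (3 ^ n * 2 * K ^ (n + 1) : ENNReal) ≠ ⊤ := by finiteness
  refine ⟨(3 ^ n * 2 * K ^ (n + 1)).toReal + 1, by positivity, ?_⟩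
  intro r hr σ hσ hσ01 jt i hi γ hγ
  have hS : 1 ≤ ∑ k : Fin r, if 2 ≤ (k : ℕ) then (jt k i) ^ 2 else 0 :=
    (Int.one_le_abs hi).trans (abs_jge3_le hσ jt i)
  have hslice : ∀ j1 : Idx (n + 1), volume {a : Fin (n + 1) → ℝ | a ∈ box (n + 1) ∧
      (2 * (1 + ∑ k : Fin r, if 2 ≤ (k : ℕ) then (jt k i) ^ 2 else 0) ≤ |j1 i|) ∧
      |gfun (n + 1) r hr σ jt j1 a| < γ * enorm (n + 1) j1 ^ (-(((n + 1 : ℕ) : ℝ) - 1)) *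
        Real.log (enorm (n + 1) j1) ^ (-(2 * ((n + 1 : ℕ) : ℝ)))} ≤
      3 ^ n * 2 * ENNReal.ofReal γ * ∏ l, ENNReal.ofReal (logWeight (j1 l)) := by
    intro j1
    by_cases hj1 : 2 * (1 + ∑ k : Fin r, if 2 ≤ (k : ℕ) then (jt k i) ^ 2 else 0) ≤ |j1 i|
    swap
    · simp [hj1]
    simp only [hj1, true_and]
    have h4 : (4 : ℝ) ≤ |(j1 i : ℝ)| := by
      have : 4 ≤ |j1 i| := by linarith
      exact_mod_cast this
    have hbox : ∀ a ∈ box (n + 1), ∀ l, 1 ≤ a l := fun a ha l => (ha l trivial).1.le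
    refine (volume_box_inter_abs_lt_le (continuous_gfun hr σ jt j1).measurable i
      (show 0 < |(j1 i : ℝ)| by linarith) fun a ha b hb hab =>
        mul_abs_sub_le_abs_gfun_sub hr hσ hσ01 jt hi hj1 (hbox a ha) (hbox b hb) hab).trans ?_
    have hsplit : 3 ^ n * 2 * ENNReal.ofReal γ * ∏ l, ENNReal.ofReal (logWeight (j1 l)) =
        3 ^ n * ENNReal.ofReal (2 * (γ * ∏ l, logWeight (j1 l))) := by
      rw [ENNReal.ofReal_mul zero_le_two, ENNReal.ofReal_mul hγ.le,
        ENNReal.ofReal_prod_of_nonneg fun l _ => logWeight_nonneg _, ENNReal.ofReal_ofNat]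
      ring
    rw [hsplit, mul_assoc γ, mul_div_assoc, mul_div_assoc]
    gcongr
    exact enorm_rpow_mul_log_rpow_div_le_prod j1 h4
  calc _ ≤ volume (⋃ j1 : Idx (n + 1), {a : Fin (n + 1) → ℝ | a ∈ box (n + 1) ∧
      (2 * (1 + ∑ k : Fin r, if 2 ≤ (k : ℕ) then (jt k i) ^ 2 else 0) ≤ |j1 i|) ∧
      |gfun (n + 1) r hr σ jt j1 a| < γ * enorm (n + 1) j1 ^ (-(((n + 1 : ℕ) : ℝ) - 1)) *
        Real.log (enorm (n + 1) j1) ^ (-(2 * ((n + 1 : ℕ) : ℝ)))}) := by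
        refine measure_mono ?_
        rintro a ⟨ha, j1, h⟩
        exact Set.mem_iUnion.mpr ⟨j1, ha, h⟩
    _ ≤ ∑' j1 : Idx (n + 1),
          3 ^ n * 2 * ENNReal.ofReal γ * ∏ l, ENNReal.ofReal (logWeight (j1 l)) :=
        (measure_iUnion_le _).trans (ENNReal.tsum_le_tsum hslice)
    _ = 3 ^ n * 2 * K ^ (n + 1) * ENNReal.ofReal γ := by
        rw [ENNReal.tsum_mul_left, tsum_prod_eq_tsum_pow fun m => ENNReal.ofReal (logWeight m)]
        ring
    _ ≤ _ := by
        rw [ENNReal.ofReal_mul (by positivity)]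
        gcongr
        exact (ENNReal.ofReal_toReal hB).symm.le.trans (ENNReal.ofReal_le_ofReal (by linarith))

end BeamPaper
end
end
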